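/- arXiv:2310.20124 — 2 statements merged into one kernel-verified Lean document; each statement's English description precedes it below -/
import Mathlib

section
/- Let E be a finite set of even cardinality |E| = 2k ≥ 2. Then the radical of the polar form b on H_E is exactly the line spanned by χ_E, and q_E(χ_E) = k mod 2 (in particular q_E(χ_E) = 0 if and only if 4 divides |E|). If |E| ≡ 0 (mod 4), then the number of vectors v ∈ H_E with q_E(v) = 1 exceeds the number with q_E(v) = 0 if and only if |E| ≡ 4 (mod 8) (i.e., writing |E| = 4m, the Arf invariant of the induced form is m mod 2). -/
open Finset

abbrev F2 := ZMod 2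

/-- `H_E`: the 𝔽₂-vector space of functions `v : E → 𝔽₂` with `∑ e, v e = 0`
(characteristic functions of even-size subsets of `E`). -/
def HE (E : Type*) [Fintype E] : Submodule F2 (E → F2) where
  carrier := {v | ∑ e, v e = 0}
  zero_mem' := by simp
  add_mem' := by
    intro a b ha hb
    simp only [Set.mem_setOf_eq] at ha hb ⊢
    simp [Finset.sum_add_distrib, ha, hb]
  smul_mem' := by
    intro c v hv
    simp only [Set.mem_setOf_eq] at hv ⊢
    simp [← Finset.mul_sum, hv]

/-- The quadratic form `q_E`, determined by `q_E(χ_A) = (|A|/2) mod 2` for even-size `A`. -/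
def qE {E : Type*} [Fintype E] [DecidableEq E] (v : E → F2) : F2 :=
  (((Finset.univ : Finset E).powersetCard 2).filter (fun p => ∀ e ∈ p, v e = 1)).card

/-- The polar form `b(v,w) = q_E(v+w) - q_E(v) - q_E(w)` of `q_E`. -/
def bE {E : Type*} [Fintype E] [DecidableEq E] (v w : E → F2) : F2 :=
  qE (v + w) - qE v - qE w

/-- The set of which `v` is the characteristic function. -/
def oneSet {E : Type*} [Fintype E] (v : E → F2) : Finset E :=
  univ.filter fun e => v e = 1

theorem F2.eq_zero_or_one : ∀ x : F2, x = 0 ∨ x = 1 := by decide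

theorem sum_eq_card_oneSet {E : Type*} [Fintype E] (v : E → F2) :
    ∑ e, v e = ((oneSet v).card : F2) := by
  rw [oneSet, Finset.card_filter, Nat.cast_sum]
  refine Finset.sum_congr rfl fun e _ => ?_
  rcases F2.eq_zero_or_one (v e) with h | h <;> simp [h]

theorem mem_HE_iff_even {E : Type*} [Fintype E] (v : E → F2) :
    v ∈ HE E ↔ Even (oneSet v).card := by
  change ∑ e, v e = 0 ↔ _
  rw [sum_eq_card_oneSet, ZMod.natCast_eq_zero_iff_even]

theorem qE_eq_choose {E : Type*} [Fintype E] [DecidableEq E] (v : E → F2) :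
    qE v = (((oneSet v).card.choose 2 : ℕ) : F2) := by
  rw [qE, ← Finset.card_powersetCard]
  congr 2
  ext p
  simp only [oneSet, Finset.mem_filter, Finset.mem_powersetCard, Finset.subset_iff,
    Finset.mem_univ, true_and]
  tauto

theorem qE_of_card_eq {E : Type*} [Fintype E] [DecidableEq E] {v : E → F2} {a : ℕ}
    (h : (oneSet v).card = 2 * a) : qE v = (a : F2) := by
  rw [qE_eq_choose, h, Nat.choose_two_right, mul_assoc, Nat.mul_div_cancel_left _ two_pos,
    ZMod.natCast_eq_natCast_iff']
  rcases Nat.eq_zero_or_pos a with rfl | ha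
  · simp
  · have : (2 * a - 1) % 2 = 1 := by omega
    rw [Nat.mul_mod, this, mul_one, Nat.mod_mod]

theorem card_oneSet_add {E : Type*} [Fintype E] (v w : E → F2) :
    (oneSet (v + w)).card + 2 * (oneSet (v * w)).card =
      (oneSet v).card + (oneSet w).card := by
  simp only [oneSet, Finset.card_filter, Finset.mul_sum, ← Finset.sum_add_distrib]
  refine Finset.sum_congr rfl fun e _ => ?_
  simp only [Pi.add_apply, Pi.mul_apply]
  have key : ∀ x y : F2, ((if x + y = 1 then 1 else 0) + 2 * if x * y = 1 then 1 else 0) =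
      (if x = 1 then 1 else 0) + if y = 1 then 1 else 0 := by decide
  convert key (v e) (w e)

theorem bE_eq_sum {E : Type*} [Fintype E] [DecidableEq E] {v w : E → F2}
    (hv : v ∈ HE E) (hw : w ∈ HE E) : bE v w = ∑ e, v e * w e := by
  obtain ⟨a, ha⟩ := even_iff_exists_two_mul.1 ((mem_HE_iff_even v).1 hv)
  obtain ⟨b, hb⟩ := even_iff_exists_two_mul.1 ((mem_HE_iff_even w).1 hw)
  obtain ⟨c, hc⟩ := even_iff_exists_two_mul.1
    ((mem_HE_iff_even (v + w)).1 ((HE E).add_mem hv hw))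
  have hadd := card_oneSet_add v w
  have hab : a + b = c + (oneSet (v * w)).card := by omega
  have hab' : (a : F2) + b = c + ((oneSet (v * w)).card : F2) := by
    rw [← Nat.cast_add, hab, Nat.cast_add]
  have hsum : ∑ e, v e * w e = ((oneSet (v * w)).card : F2) := sum_eq_card_oneSet (v * w)
  rw [bE, qE_of_card_eq ha, qE_of_card_eq hb, qE_of_card_eq hc, hsum, sub_sub, hab',
    sub_add_cancel_left, ZMod.neg_eq_self_mod_two]

theorem oneSet_one {E : Type*} [Fintype E] : oneSet (fun _ : E => (1 : F2)) = univ := by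
  simp [oneSet]

/-- The radical of the polar form is spanned by the constant function `1`. -/
theorem radical_bE {E : Type*} [Fintype E] [DecidableEq E] (hE : Even (Fintype.card E)) :
    {v : E → F2 | v ∈ HE E ∧ ∀ w : E → F2, w ∈ HE E → bE v w = 0}
      = {0, fun _ => (1 : F2)} := by
  ext v
  simp only [Set.mem_ofPred_eq, Set.mem_insert_iff, Set.mem_singleton_iff]
  constructor
  · rintro ⟨hv, h⟩
    have hconst : ∀ i j, v i = v j := by
      intro i j
      have hw : (Pi.single i 1 + Pi.single j 1 : E → F2) ∈ HE E := by
        change ∑ e, (Pi.single i 1 + Pi.single j 1 : E → F2) e = 0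
        simp only [Pi.add_apply, Finset.sum_add_distrib, Finset.sum_pi_single', Finset.mem_univ,
          if_true, CharTwo.add_self_eq_zero]
      have := h _ hw
      rw [bE_eq_sum hv hw] at this
      simp only [Pi.add_apply, mul_add, Finset.sum_add_distrib, Pi.single_apply, mul_ite, mul_one,
        mul_zero, Finset.sum_ite_eq', Finset.mem_univ, if_true] at this
      exact CharTwo.add_eq_zero.1 this
    by_cases h1 : ∃ i, v i = 1
    · obtain ⟨i, hi⟩ := h1
      exact Or.inr (funext fun j => (hconst j i).trans hi)
    · exact Or.inl (funext fun j => (F2.eq_zero_or_one (v j)).resolve_right fun hj => h1 ⟨j, hj⟩)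
  · have h1 : (fun _ : E => (1 : F2)) ∈ HE E := by
      rw [mem_HE_iff_even, oneSet_one]
      exact hE
    rintro (rfl | rfl)
    · refine ⟨(HE E).zero_mem, fun w hw => ?_⟩
      simp [bE_eq_sum (HE E).zero_mem hw]
    · refine ⟨h1, fun w hw => ?_⟩
      rw [bE_eq_sum h1 hw]
      simp only [one_mul]
      exact hw

theorem sum_I_pow_card_oneSet (E : Type*) [Fintype E] [DecidableEq E] :
    ∑ v : E → F2, Complex.I ^ (oneSet v).card = (1 + Complex.I) ^ Fintype.card E := by
  have h := Finset.prod_univ_sum (fun _ : E => (univ : Finset F2))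
    (fun _ x => if x = 1 then Complex.I else 1)
  have hsum : ∑ x : F2, (if x = 1 then Complex.I else 1) = 1 + Complex.I :=
    Fin.sum_univ_two _
  rw [Fintype.piFinset_univ, Finset.prod_const, hsum, Finset.card_univ] at h
  rw [h]
  refine Finset.sum_congr rfl fun v _ => ?_
  rw [Finset.prod_ite, Finset.prod_const, Finset.prod_const_one, mul_one, oneSet]

open Classical in
theorem re_I_pow_card_oneSet {E : Type*} [Fintype E] [DecidableEq E] (v : E → F2) :
    (Complex.I ^ (oneSet v).card).re =
      (if v ∈ HE E ∧ qE v = 0 then 1 else 0) - (if v ∈ HE E ∧ qE v = 1 then 1 else 0) := by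
  rcases Nat.even_or_odd' (oneSet v).card with ⟨a, ha | ha⟩
  · have hv : v ∈ HE E := (mem_HE_iff_even v).2 (by simp [ha])
    rw [qE_of_card_eq ha, ha, pow_mul, Complex.I_sq]
    rcases Nat.even_or_odd a with h | h
    · simp [hv, h.neg_one_pow, ZMod.natCast_eq_zero_iff_even.2 h]
    · simp [hv, h.neg_one_pow, ZMod.natCast_eq_one_iff_odd.2 h]
  · have hv : v ∉ HE E := by
      rw [mem_HE_iff_even, ha, Nat.not_even_iff_odd]
      exact odd_two_mul_add_one a
    have hre : ((-1 : ℂ) ^ a * Complex.I).re = 0 := by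
      rcases neg_one_pow_eq_or ℂ a with h | h <;> simp [h]
    rw [ha, pow_succ, pow_mul, Complex.I_sq, hre]
    simp [hv]

/-- For `|E| = 4m`, the zeros of `q_E` outnumber its ones by `(-4)^m`. -/
theorem card_qE_zero_sub_card_qE_one {E : Type*} [Fintype E] [DecidableEq E] {m : ℕ}
    (hm : Fintype.card E = 4 * m) :
    (Nat.card {v : E → F2 // v ∈ HE E ∧ qE v = 0} : ℝ) -
      Nat.card {v : E → F2 // v ∈ HE E ∧ qE v = 1} = (-4) ^ m := by
  classical
  have h := congrArg Complex.re (sum_I_pow_card_oneSet E)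
  have h4 : (1 + Complex.I) ^ 4 = ((-4 : ℝ) : ℂ) := by
    have h2 : (1 + Complex.I) ^ 2 = 2 * Complex.I := by
      linear_combination Complex.I_sq
    rw [show 4 = 2 * 2 from rfl, pow_mul, h2, mul_pow, Complex.I_sq]
    norm_num
  rw [hm, pow_mul, h4, ← Complex.ofReal_pow, Complex.ofReal_re, Complex.re_sum] at h
  simp only [re_I_pow_card_oneSet, Finset.sum_sub_distrib, Finset.sum_boole] at h
  rw [← h, Nat.card_eq_fintype_card, Nat.card_eq_fintype_card, Fintype.card_subtype,
    Fintype.card_subtype]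

/-- For `|E| = 2k ≥ 2`: the radical of the polar form on `H_E` is exactly `{0, χ_E}` (the
line spanned by `χ_E`), `q_E(χ_E) = k mod 2` (so `q_E(χ_E) = 0` iff `4 ∣ |E|`), and when
`4 ∣ |E|` the value `1` is taken more often than `0` iff `|E| ≡ 4 (mod 8)`. -/
theorem statement1 (E : Type*) [Fintype E] [DecidableEq E] (k : ℕ) (hk : 1 ≤ k)
    (hcard : Fintype.card E = 2 * k) :
    ({v : E → F2 | v ∈ HE E ∧ ∀ w : E → F2, w ∈ HE E → bE v w = 0}
        = {0, fun _ => (1 : F2)}) ∧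
    qE (fun _ : E => (1 : F2)) = (k : F2) ∧
    ((qE (fun _ : E => (1 : F2)) = 0) ↔ Fintype.card E % 4 = 0) ∧
    (Fintype.card E % 4 = 0 →
      (Nat.card {v : E → F2 // v ∈ HE E ∧ qE v = 1} >
          Nat.card {v : E → F2 // v ∈ HE E ∧ qE v = 0} ↔
        Fintype.card E % 8 = 4)) := by
  have hq : qE (fun _ : E => (1 : F2)) = (k : F2) :=
    qE_of_card_eq (by rw [oneSet_one, Finset.card_univ, hcard])
  refine ⟨radical_bE (hcard ▸ even_two_mul k), hq, ?_, fun h4 => ?_⟩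
  · rw [hq, ZMod.natCast_eq_zero_iff_even, Nat.even_iff]
    omega
  · obtain ⟨m, hm⟩ := Nat.dvd_of_mod_eq_zero h4
    have hdiff := card_qE_zero_sub_card_qE_one hm
    rw [gt_iff_lt, ← Nat.cast_lt (α := ℝ), ← sub_neg, hdiff]
    rcases Nat.even_or_odd m with h | h
    · have hpos : (0 : ℝ) < (-4) ^ m := h.pow_pos (by norm_num)
      have hmod := Nat.even_iff.1 h
      exact iff_of_false hpos.not_gt (by omega)
    · have hneg : (-4 : ℝ) ^ m < 0 := h.pow_neg (by norm_num)
      have hmod := Nat.odd_iff.1 h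
      exact iff_of_true hneg (by omega)
end

section
/- The Eisenstein lattice L₁ ⊥ L₃ ⊥ 𝓗 is isomorphic to L₄ ⊥ 𝓗(θ): there exists a 6×6 matrix U over 𝓔, invertible over 𝓔, such that Uᴴ · diag([3], G₃, G_H) · U = diag(G₄, G_{H(θ)}), where G_{H(θ)} := [[0, −3], [−3, 0]]. -/
open Matrix

/-- `ω = (−1+√−3)/2`, a primitive cube root of unity in `ℂ`. -/
noncomputable def ω : ℂ := (-1 + Complex.I * Real.sqrt 3) / 2

/-- `θ = ω − ω̄ = √−3`. -/
noncomputable def θ : ℂ := Complex.I * Real.sqrt 3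

/-- The ring `𝓔 = ℤ[ω]` of Eisenstein integers, as a subring of `ℂ`. -/
def Eis : Subring ℂ := Subring.closure {ω}

/-- The Gram matrix `Gₙ` of the Eisenstein lattice `Lₙ`: diagonal entries `3`, entries
`θ` and `−θ` next to the diagonal, `0` elsewhere. -/
noncomputable def Gm (n : ℕ) : Matrix (Fin n) (Fin n) ℂ :=
  Matrix.of fun i j =>
    if i = j then 3
    else if (i : ℕ) + 1 = (j : ℕ) then θ
    else if (j : ℕ) + 1 = (i : ℕ) then -θ
    else 0

/-- The Gram matrix of the hyperbolic Eisenstein lattice `𝓗`. -/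
noncomputable def GH : Matrix (Fin 2) (Fin 2) ℂ := !![0, θ; -θ, 0]

/-- A matrix has all its entries in `𝓔`. -/
def EisEntries {m n : Type*} (U : Matrix m n ℂ) : Prop := ∀ i j, U i j ∈ Eis

/-- A (possibly rectangular) matrix is invertible over `𝓔`: it has a two-sided inverse
with entries in `𝓔`. -/
def EisInvertible {m n : Type*} [Fintype m] [Fintype n] [DecidableEq m] [DecidableEq n]
    (U : Matrix m n ℂ) : Prop :=
  EisEntries U ∧ ∃ W : Matrix n m ℂ, EisEntries W ∧ U * W = 1 ∧ W * U = 1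

/-- The Gram matrix of the lattice `𝓗(θ)`. -/
noncomputable def GHθ : Matrix (Fin 2) (Fin 2) ℂ := !![0, -3; -3, 0]

theorem ω_mul_self : ω * ω = -1 - ω := by
  have h : (Real.sqrt 3 : ℂ) * Real.sqrt 3 = 3 := by
    rw [← Complex.ofReal_mul, Real.mul_self_sqrt (by norm_num)]
    norm_num
  simp only [ω]
  linear_combination (1 / 4 : ℂ) * (Real.sqrt 3 : ℂ) ^ 2 * Complex.I_mul_I - (1 / 4 : ℂ) * h

theorem θ_eq : θ = 1 + 2 * ω := by
  simp only [ω, θ]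
  ring

theorem star_ω : star ω = -1 - ω := by
  simp only [ω, Complex.star_def, map_div₀, map_add, map_mul, map_neg, map_one,
    Complex.conj_I, Complex.conj_ofReal, map_ofNat]
  ring

theorem ω_mem_Eis : ω ∈ Eis := Subring.subset_closure rfl

/-- The columns express a basis of `L₄ ⊥ 𝓗(θ)` in terms of a basis of `L₁ ⊥ L₃ ⊥ 𝓗`. -/
noncomputable def changeOfBasis : Matrix (Fin 1 ⊕ (Fin 3 ⊕ Fin 2)) (Fin 4 ⊕ Fin 2) ℂ :=
  fromRows (fromCols !![0, 0, 0, 0] !![1, -1 - ω])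
    (fromRows
      (fromCols !![0, 0, 0, -1 - ω; 1, 0, 0, -ω; 0, 1, 0, 1] !![1, -ω; 0, 0; 1, -ω])
      (fromCols !![0, 0, 1, 1 + ω; 0, -1, -1 - ω, 0] !![1 + 2 * ω, 2 + ω; -2 - ω, -1 + ω]))

/-- The inverse of `changeOfBasis`. -/
noncomputable def changeOfBasisInv : Matrix (Fin 4 ⊕ Fin 2) (Fin 1 ⊕ (Fin 3 ⊕ Fin 2)) ℂ :=
  fromRows
    (fromCols !![0; 0; 0; 0]
      (fromCols
        !![-2 - 2 * ω, 1, -1 - ω; 1 - 2 * ω, 0, 2 - ω; 3 + 2 * ω, 0, 2 + 2 * ω; 2 * ω, 0, ω]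
        !![-ω, -1 - ω; 2 + ω, 1 - ω; 1 + 2 * ω, 2 + 2 * ω; -1, ω]))
    (fromCols !![-ω; -1]
      (fromCols !![-1 - ω, 0, -1 - ω; -1, 0, -1] !![-ω, -1 - ω; -1 - ω, -1]))

theorem eisEntries_changeOfBasis : EisEntries changeOfBasis := by
  have h := ω_mem_Eis
  rintro (i | i | i) (j | j) <;> fin_cases i <;> fin_cases j <;>
    simp [changeOfBasis, h, one_mem, ofNat_mem, add_mem, sub_mem, mul_mem]

theorem eisEntries_changeOfBasisInv : EisEntries changeOfBasisInv := by
  have h := ω_mem_Eis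
  rintro (i | i) (j | j | j) <;> fin_cases i <;> fin_cases j <;>
    simp [changeOfBasisInv, h, one_mem, ofNat_mem, add_mem, sub_mem, mul_mem]

theorem changeOfBasis_mul_inv : changeOfBasis * changeOfBasisInv = 1 := by
  have h := ω_mul_self
  ext (i | i | i) (j | j | j) <;> fin_cases i <;> fin_cases j <;>
    simp [changeOfBasis, changeOfBasisInv, Matrix.mul_apply, Fin.sum_univ_succ] <;>
    grind

theorem changeOfBasisInv_mul : changeOfBasisInv * changeOfBasis = 1 :=
  (Matrix.mul_eq_one_comm_of_card_eq _ _ _ (by simp)).1 changeOfBasis_mul_inv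

/-- Statement 14: `L₁ ⊥ L₃ ⊥ 𝓗 ≅ L₄ ⊥ 𝓗(θ)`. -/
theorem statement14 :
    ∃ U : Matrix (Fin 1 ⊕ (Fin 3 ⊕ Fin 2)) (Fin 4 ⊕ Fin 2) ℂ,
      EisInvertible U ∧
      Uᴴ * Matrix.fromBlocks (Gm 1) 0 0 (Matrix.fromBlocks (Gm 3) 0 0 GH) * U =
        Matrix.fromBlocks (Gm 4) 0 0 GHθ := by
  refine ⟨changeOfBasis, ⟨eisEntries_changeOfBasis, changeOfBasisInv,
    eisEntries_changeOfBasisInv, changeOfBasis_mul_inv, changeOfBasisInv_mul⟩, ?_⟩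
  have h := ω_mul_self
  have hs : (starRingEnd ℂ) ω = -1 - ω := star_ω
  have h2 : (starRingEnd ℂ) 2 = 2 := map_ofNat _ 2
  ext (i | i) (j | j) <;> fin_cases i <;> fin_cases j <;>
    simp [changeOfBasis, Matrix.mul_apply, Fin.sum_univ_succ, Gm, GH, GHθ, θ_eq, hs,
      h2] <;>
    grind
end
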